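/- In the infinitesimal braid Lie algebra 𝔱_3 over ℚ: (1) the element c := t_{12} + t_{13} + t_{23} is central; (2) the Lie algebra morphism from the free Lie algebra on two generators x, y over ℚ to 𝔱_3 sending x ↦ t_{12} and y ↦ t_{23} is injective; (3) 𝔱_3 decomposes as the internal direct sum 𝔱_3 = ℚ·c ⊕ 𝔥, where 𝔥 is the Lie subalgebra generated by t_{12} and t_{23} (which by (2) is free on these two elements). -/

import Mathlib

noncomputable section

/-- Generators of the infinitesimal braid Lie algebra: unordered pairs `{i,j} ⊆ [n]`
with `i ≠ j`. -/
abbrev BraidGen (n : ℕ) := {s : Sym2 (Fin n) // ¬ s.IsDiag}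

/-- The free Lie algebra over ℚ on the generators `t_{ij} = t_{ji}`, `i ≠ j`. -/
abbrev FreeT (n : ℕ) := FreeLieAlgebra ℚ (BraidGen n)

/-- The generator `t_{ij}` of the free Lie algebra, for `i ≠ j`. -/
def tfree {n : ℕ} (i j : Fin n) (h : i ≠ j) : FreeT n :=
  FreeLieAlgebra.of ℚ ⟨s(i, j), by simpa using h⟩

/-- The infinitesimal braid relations: `[t_{ij}, t_{kl}]` for `{i,j} ∩ {k,l} = ∅` and
`[t_{ij} + t_{jk}, t_{ik}]` for `i, j, k` distinct. -/
def braidRels (n : ℕ) : Set (FreeT n) :=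
  {x | ∃ (i j k l : Fin n) (hij : i ≠ j) (hkl : k ≠ l),
      i ≠ k ∧ i ≠ l ∧ j ≠ k ∧ j ≠ l ∧ x = ⁅tfree i j hij, tfree k l hkl⁆} ∪
  {x | ∃ (i j k : Fin n) (hij : i ≠ j) (hjk : j ≠ k) (hik : i ≠ k),
      x = ⁅tfree i j hij + tfree j k hjk, tfree i k hik⁆}

/-- The Lie ideal of `FreeT n` generated by the infinitesimal braid relations. -/
def braidIdeal (n : ℕ) : LieIdeal ℚ (FreeT n) :=
  LieSubmodule.lieSpan ℚ (FreeT n) (braidRels n)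

/-- The infinitesimal braid Lie algebra `𝔱_n` on `n` strands over ℚ. -/
abbrev T (n : ℕ) := FreeT n ⧸ braidIdeal n

/-- The generator `t_{ij}` of `𝔱_n` (with junk value `0` when `i = j`). -/
def tgen {n : ℕ} (i j : Fin n) : T n :=
  if h : i ≠ j then LieSubmodule.Quotient.mk (N := braidIdeal n) (tfree i j h) else 0

/-- A Lie subalgebra of a free Lie algebra that contains the generators is everything. -/
theorem FreeLieAlgebra.mem_of_forall_of_mem {R X : Type*} [CommRing R]
    (S : LieSubalgebra R (FreeLieAlgebra R X)) (h : ∀ x, FreeLieAlgebra.of R x ∈ S)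
    (a : FreeLieAlgebra R X) : a ∈ S := by
  let f : FreeLieAlgebra R X →ₗ⁅R⁆ S := FreeLieAlgebra.lift R fun x => ⟨FreeLieAlgebra.of R x, h x⟩
  have hf : S.incl.comp f = LieHom.id := by
    ext x
    simp [f]
  have ha : (f a : FreeLieAlgebra R X) = a := LieHom.congr_fun hf a
  exact ha ▸ (f a).2

/-- The Lie algebra morphism induced on the quotient by a Lie ideal on which `f` vanishes. -/
def LieIdeal.quotientLift {R L L' : Type*} [CommRing R] [LieRing L] [LieAlgebra R L] [LieRing L']
    [LieAlgebra R L'] (I : LieIdeal R L) (f : L →ₗ⁅R⁆ L') (h : I ≤ f.ker) : L ⧸ I →ₗ⁅R⁆ L' :=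
  { I.toSubmodule.liftQ (f : L →ₗ[R] L') fun x hx => f.mem_ker.1 (h hx) with
    map_lie' := by
      intro x y
      obtain ⟨x, rfl⟩ := LieSubmodule.Quotient.surjective_mk' I x
      obtain ⟨y, rfl⟩ := LieSubmodule.Quotient.surjective_mk' I y
      exact f.map_lie x y }

theorem LieIdeal.quotientLift_mk {R L L' : Type*} [CommRing R] [LieRing L] [LieAlgebra R L]
    [LieRing L'] [LieAlgebra R L'] (I : LieIdeal R L) (f : L →ₗ⁅R⁆ L') (h : I ≤ f.ker) (x : L) :
    I.quotientLift f h (LieSubmodule.Quotient.mk x) = f x :=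
  rfl

theorem tgen_of_ne {n : ℕ} {i j : Fin n} (h : i ≠ j) :
    tgen i j = LieSubmodule.Quotient.mk (N := braidIdeal n) (tfree i j h) :=
  dif_pos h

theorem tgen_comm {n : ℕ} (i j : Fin n) : tgen i j = tgen j i := by
  by_cases h : i = j
  · rw [h]
  · simp only [tgen_of_ne h, tgen_of_ne (Ne.symm h), tfree, Sym2.eq_swap]

theorem lie_tgen_add_tgen {n : ℕ} {i j k : Fin n} (hij : i ≠ j) (hjk : j ≠ k) (hik : i ≠ k) :
    ⁅tgen i j + tgen j k, tgen i k⁆ = 0 := by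
  rw [tgen_of_ne hij, tgen_of_ne hjk, tgen_of_ne hik]
  exact (LieSubmodule.Quotient.mk_eq_zero' (N := braidIdeal n)).2
    (LieSubmodule.subset_lieSpan (Or.inr ⟨i, j, k, hij, hjk, hik, rfl⟩))

theorem mem_of_forall_tgen_mem {n : ℕ} (S : LieSubalgebra ℚ (T n))
    (h : ∀ i j : Fin n, i ≠ j → tgen i j ∈ S) (x : T n) : x ∈ S := by
  let π : FreeT n →ₗ⁅ℚ⁆ T n :=
    { (braidIdeal n).toSubmodule.mkQ with map_lie' := rfl }
  obtain ⟨x, rfl⟩ := LieSubmodule.Quotient.surjective_mk' (braidIdeal n) x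
  refine FreeLieAlgebra.mem_of_forall_of_mem (S.comap π) ?_ x
  rintro ⟨s, hs⟩
  induction s using Sym2.ind with
  | _ i j =>
    have hij : i ≠ j := by simpa using hs
    have := h i j hij
    rwa [tgen_of_ne hij] at this

theorem mem_of_tgen_three_mem (S : LieSubalgebra ℚ (T 3)) (h₀₁ : tgen 0 1 ∈ S)
    (h₀₂ : tgen 0 2 ∈ S) (h₁₂ : tgen 1 2 ∈ S) (x : T 3) : x ∈ S := by
  refine mem_of_forall_tgen_mem S (fun i j hij => ?_) x
  fin_cases i <;> fin_cases j <;> first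
    | exact absurd rfl hij
    | assumption
    | (rw [tgen_comm]; assumption)

theorem lie_tgen_sum_three (x : T 3) :
    ⁅tgen (0 : Fin 3) 1 + tgen (0 : Fin 3) 2 + tgen (1 : Fin 3) 2, x⁆ = 0 := by
  set c : T 3 := tgen (0 : Fin 3) 1 + tgen (0 : Fin 3) 2 + tgen (1 : Fin 3) 2 with hc
  let S : LieSubalgebra ℚ (T 3) :=
    { LinearMap.ker (LieAlgebra.ad ℚ (T 3) c : T 3 →ₗ[ℚ] T 3) with
      lie_mem' := by
        intro x y hx hy
        change ⁅c, x⁆ = 0 at hx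
        change ⁅c, y⁆ = 0 at hy
        change ⁅c, ⁅x, y⁆⁆ = 0
        rw [leibniz_lie, hx, hy, zero_lie, lie_zero, add_zero] }
  refine mem_of_tgen_three_mem S ?_ ?_ ?_ x
  · have h := lie_tgen_add_tgen (n := 3) (i := 0) (j := 2) (k := 1)
      (by decide) (by decide) (by decide)
    rw [tgen_comm (2 : Fin 3) 1] at h
    change ⁅c, tgen (0 : Fin 3) 1⁆ = 0
    rw [hc, add_assoc, add_lie, lie_self, h, add_zero]
  · have h := lie_tgen_add_tgen (n := 3) (i := 0) (j := 1) (k := 2)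
      (by decide) (by decide) (by decide)
    change ⁅c, tgen (0 : Fin 3) 2⁆ = 0
    rw [hc, add_right_comm, add_lie, lie_self, h, add_zero]
  · have h := lie_tgen_add_tgen (n := 3) (i := 1) (j := 0) (k := 2)
      (by decide) (by decide) (by decide)
    rw [tgen_comm (1 : Fin 3) 0] at h
    change ⁅c, tgen (1 : Fin 3) 2⁆ = 0
    rw [hc, add_lie, lie_self, h, add_zero]

/-- The images of the generators of `𝔱_3` under the retraction onto the free Lie algebra on two
generators: `t_{12} ↦ x`, `t_{23} ↦ y`, `t_{13} ↦ -x - y`. -/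
def retractionGen (s : BraidGen 3) : FreeLieAlgebra ℚ (Fin 2) :=
  if s.1 = s(0, 1) then FreeLieAlgebra.of ℚ 0
  else if s.1 = s(1, 2) then FreeLieAlgebra.of ℚ 1
  else -FreeLieAlgebra.of ℚ 0 - FreeLieAlgebra.of ℚ 1

theorem braidIdeal_three_le_ker :
    braidIdeal 3 ≤ (FreeLieAlgebra.lift ℚ retractionGen).ker := by
  refine LieSubmodule.lieSpan_le.2 ?_
  rintro _ (⟨i, j, k, l, hij, hkl, hik, hil, hjk, hjl, rfl⟩ | ⟨i, j, k, hij, hjk, hik, rfl⟩)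
  · omega
  · have key : retractionGen ⟨s(i, j), by simpa using hij⟩ +
        retractionGen ⟨s(j, k), by simpa using hjk⟩ =
          -retractionGen ⟨s(i, k), by simpa using hik⟩ := by
      fin_cases i <;> fin_cases j <;> first
        | exact absurd rfl hij
        | (fin_cases k <;> first
            | exact absurd rfl hik
            | exact absurd rfl hjk
            | (simp [retractionGen]; try abel))
    rw [SetLike.mem_coe, LieHom.mem_ker, LieHom.map_lie, map_add]
    simp only [tfree, FreeLieAlgebra.lift_of_apply]
    rw [key, neg_lie, lie_self, neg_zero]

/-- The morphism from `𝔱_3` to the free Lie algebra on two generators killing the central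
element `t_{12} + t_{13} + t_{23}`. -/
def retraction : T 3 →ₗ⁅ℚ⁆ FreeLieAlgebra ℚ (Fin 2) :=
  (braidIdeal 3).quotientLift (FreeLieAlgebra.lift ℚ retractionGen) braidIdeal_three_le_ker

theorem retraction_tgen {i j : Fin 3} (h : i ≠ j) :
    retraction (tgen i j) = retractionGen ⟨s(i, j), by simpa using h⟩ := by
  rw [tgen_of_ne h, retraction, LieIdeal.quotientLift_mk, tfree, FreeLieAlgebra.lift_of_apply]

theorem retraction_tgen_zero_one : retraction (tgen 0 1) = FreeLieAlgebra.of ℚ 0 := by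
  rw [retraction_tgen (by decide)]
  simp [retractionGen]

theorem retraction_tgen_one_two : retraction (tgen 1 2) = FreeLieAlgebra.of ℚ 1 := by
  rw [retraction_tgen (by decide)]
  simp [retractionGen]

theorem retraction_tgen_zero_two :
    retraction (tgen 0 2) = -FreeLieAlgebra.of ℚ 0 - FreeLieAlgebra.of ℚ 1 := by
  rw [retraction_tgen (by decide)]
  simp [retractionGen]

theorem retraction_comp_lift :
    retraction.comp (FreeLieAlgebra.lift ℚ
      (fun b : Fin 2 => if b = 0 then tgen (0 : Fin 3) 1 else tgen (1 : Fin 3) 2)) =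
      LieHom.id := by
  ext b
  fin_cases b
  · simp [retraction_tgen_zero_one]
  · simp [retraction_tgen_one_two]

/-- 0-indexed: `t 0 1 = t_{12}`, `t 0 2 = t_{13}`, `t 1 2 = t_{23}`:
in `𝔱_3`, (1) `c = t_{12} + t_{13} + t_{23}` is central; (2) the morphism from the free
Lie algebra on two generators sending `x ↦ t_{12}`, `y ↦ t_{23}` is injective;
(3) `𝔱_3 = ℚ·c ⊕ 𝔥` where `𝔥` is the Lie subalgebra generated by `t_{12}` and
`t_{23}`. -/
theorem stmt6 :
    (∀ x : T 3, ⁅tgen (0 : Fin 3) 1 + tgen (0 : Fin 3) 2 + tgen (1 : Fin 3) 2, x⁆ = 0) ∧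
    Function.Injective
      (FreeLieAlgebra.lift ℚ
        (fun b : Fin 2 => if b = 0 then tgen (0 : Fin 3) 1 else tgen (1 : Fin 3) 2)) ∧
    IsCompl
      (Submodule.span ℚ
        {(tgen (0 : Fin 3) 1 + tgen (0 : Fin 3) 2 + tgen (1 : Fin 3) 2 : T 3)})
      (LieSubalgebra.lieSpan ℚ (T 3)
        {tgen (0 : Fin 3) 1, tgen (1 : Fin 3) 2}).toSubmodule := by
  have hret := LieHom.congr_fun retraction_comp_lift
  refine ⟨lie_tgen_sum_three, Function.LeftInverse.injective hret, ?_⟩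
  set c : T 3 := tgen (0 : Fin 3) 1 + tgen (0 : Fin 3) 2 + tgen (1 : Fin 3) 2 with hc
  set H := LieSubalgebra.lieSpan ℚ (T 3) {tgen (0 : Fin 3) 1, tgen (1 : Fin 3) 2} with hH
  set f := FreeLieAlgebra.lift ℚ
    (fun b : Fin 2 => if b = 0 then tgen (0 : Fin 3) 1 else tgen (1 : Fin 3) 2) with hf
  have h₀₁ : tgen 0 1 ∈ H := LieSubalgebra.subset_lieSpan (by simp)
  have h₁₂ : tgen 1 2 ∈ H := LieSubalgebra.subset_lieSpan (by simp)
  have hcc (x : T 3) : ⁅c, x⁆ = 0 := lie_tgen_sum_three x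
  have hcc' (x : T 3) : ⁅x, c⁆ = 0 := by rw [← lie_skew, hcc, neg_zero]
  constructor
  · rw [Submodule.disjoint_def]
    intro x hx hxH
    have hle : H ≤ f.range := by
      refine LieSubalgebra.lieSpan_le.2 ?_
      rintro _ (rfl | rfl)
      · exact ⟨FreeLieAlgebra.of ℚ 0, by simp [hf]⟩
      · exact ⟨FreeLieAlgebra.of ℚ 1, by simp [hf]⟩
    obtain ⟨a, rfl⟩ := Submodule.mem_span_singleton.1 hx
    obtain ⟨y, hy⟩ := hle hxH
    have hrc : retraction c = 0 := by
      rw [hc, map_add, map_add, retraction_tgen_zero_one, retraction_tgen_zero_two,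
        retraction_tgen_one_two]
      abel
    have hy0 : y = 0 := by
      have h : retraction (f y) = y := hret y
      have hy' : f y = a • c := hy
      rw [← h, hy', map_smul, hrc, smul_zero]
    rw [← hy, hy0]
    exact map_zero f
  · rw [codisjoint_iff, Submodule.eq_top_iff']
    let S : LieSubalgebra ℚ (T 3) :=
      { Submodule.span ℚ {c} ⊔ H.toSubmodule with
        lie_mem' := by
          intro x y hx hy
          obtain ⟨_, ha, x, hxH, rfl⟩ := Submodule.mem_sup.1 hx
          obtain ⟨_, hb, y, hyH, rfl⟩ := Submodule.mem_sup.1 hy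
          obtain ⟨a, rfl⟩ := Submodule.mem_span_singleton.1 ha
          obtain ⟨b, rfl⟩ := Submodule.mem_span_singleton.1 hb
          have h : ⁅a • c + x, b • c + y⁆ = ⁅x, y⁆ := by
            simp [hcc, hcc']
          rw [h]
          exact Submodule.mem_sup_right (H.lie_mem hxH hyH) }
    have hcS : c ∈ S := Submodule.mem_sup_left (Submodule.mem_span_singleton_self c)
    have h₀₁S : tgen 0 1 ∈ S := Submodule.mem_sup_right h₀₁
    have h₁₂S : tgen 1 2 ∈ S := Submodule.mem_sup_right h₁₂
    have h₀₂ : tgen 0 2 = c - tgen 0 1 - tgen 1 2 := by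
      rw [hc]
      abel
    exact mem_of_tgen_three_mem S h₀₁S (h₀₂ ▸ S.sub_mem (S.sub_mem hcS h₀₁S) h₁₂S) h₁₂S
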